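/- arXiv:2003.09495 — 2 statements merged into one kernel-verified Lean document; each statement's English description precedes it below -/
import Mathlib

section
/- Let (A, β) be a rational circuit in ℝⁿ with A ⊆ ℚⁿ, where β ∈ ℕⁿ has at least one odd coordinate, with λ_α = p_α/p, m = ⌈log₂ p⌉ and leaf assignment σ. A vector v ∈ ℝ^{A∪{β}} lies in the dual cone (Pᵒ(A, β))* if and only if there exist a real number y_β with y_β ≥ |v_β| and real numbers y_{k,i} (1 ≤ k ≤ m−1, 1 ≤ i ≤ 2^{m−k}) such that, setting y_{0,j} := v_{σ(j)} if σ(j) ∈ A, y_{0,j} := y_β if σ(j) = β, and y_{m,1} := y_β, all values y_{k,i} (0 ≤ k ≤ m) are nonnegative and y_{k,i}² ≤ y_{k−1,2i−1}·y_{k−1,2i} for all 1 ≤ k ≤ m, 1 ≤ i ≤ 2^{m−k}. -/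
attribute [local instance] Classical.propDecidable

noncomputable section

/-- Membership in the cone `Pᵒ(A, β)` of nonnegative odd AG functions. -/
def InPo (n : ℕ) (A : Finset (Fin n → ℝ)) (β : Fin n → ℕ) (c : (Fin n → ℝ) → ℝ) : Prop :=
  (∀ α ∈ A, 0 ≤ c α) ∧
    ∀ x : Fin n → ℝ, (∀ i, x i ≠ 0) →
      0 ≤ ∑ α ∈ A, c α * ∏ i, |x i| ^ (α i)
            + c (fun i => (β i : ℝ)) * ∏ i, x i ^ (β i)

lemma aux_pair (f : ℕ → ℝ) (N : ℕ) :
    ∏ i ∈ Finset.Icc 1 (2 * N), f i = ∏ i ∈ Finset.Icc 1 N, (f (2 * i - 1) * f (2 * i)) := by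
  induction N with
  | zero => simp
  | succ N ih =>
    rw [show 2 * (N + 1) = 2 * N + 1 + 1 by ring, Finset.prod_Icc_succ_top (by omega),
      Finset.prod_Icc_succ_top (by omega), ih, Finset.prod_Icc_succ_top (by omega)]
    rw [show 2 * (N + 1) - 1 = 2 * N + 1 by omega, show 2 * (N + 1) = 2 * N + 1 + 1 by ring]
    ring

lemma aux_tree_le (m : ℕ) (y : ℕ → ℕ → ℝ)
    (h0 : ∀ k, k ≤ m → ∀ i ∈ Finset.Icc 1 (2 ^ (m - k)), 0 ≤ y k i)
    (h1 : ∀ k, 1 ≤ k → k ≤ m → ∀ i ∈ Finset.Icc 1 (2 ^ (m - k)),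
          (y k i) ^ 2 ≤ y (k - 1) (2 * i - 1) * y (k - 1) (2 * i)) :
    y m 1 ^ (2 ^ m) ≤ ∏ j ∈ Finset.Icc 1 (2 ^ m), y 0 j := by
  have key : ∀ k, k ≤ m → (∏ i ∈ Finset.Icc 1 (2 ^ (m - k)), y k i) ^ (2 ^ k) ≤
      ∏ j ∈ Finset.Icc 1 (2 ^ m), y 0 j := by
    intro k
    induction k with
    | zero => intro _; simp
    | succ k ih =>
      intro hk
      refine le_trans ?_ (ih (by omega))
      rw [pow_succ' 2 k, pow_mul]
      apply pow_le_pow_left₀ (by positivity)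
      rw [show m - k = (m - (k + 1)) + 1 by omega, pow_succ' 2 (m - (k+1)), aux_pair,
        ← Finset.prod_pow]
      apply Finset.prod_le_prod
      · intro i _; positivity
      · intro i hi
        exact h1 (k + 1) (by omega) hk i hi
  simpa using key m le_rfl

def auxY (l : ℕ → ℝ) : ℕ → ℕ → ℝ
  | 0, j => l j
  | k + 1, i => Real.sqrt (auxY l k (2 * i - 1) * auxY l k (2 * i))

lemma auxY_nonneg (m : ℕ) (l : ℕ → ℝ) (hl : ∀ j ∈ Finset.Icc 1 (2 ^ m), 0 ≤ l j) :
    ∀ k, k ≤ m → ∀ i ∈ Finset.Icc 1 (2 ^ (m - k)), 0 ≤ auxY l k i := by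
  intro k hk i hi
  cases k with
  | zero => exact hl i (by simpa using hi)
  | succ k => exact Real.sqrt_nonneg _

lemma auxY_sq (m : ℕ) (l : ℕ → ℝ) (hl : ∀ j ∈ Finset.Icc 1 (2 ^ m), 0 ≤ l j) :
    ∀ k, 1 ≤ k → k ≤ m → ∀ i ∈ Finset.Icc 1 (2 ^ (m - k)),
          (auxY l k i) ^ 2 = auxY l (k - 1) (2 * i - 1) * auxY l (k - 1) (2 * i) := by
  intro k hk1 hk i hi
  obtain ⟨k, rfl⟩ : ∃ k', k = k' + 1 := ⟨k - 1, by omega⟩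
  have e : 2 ^ (m - k) = 2 * 2 ^ (m - (k + 1)) := by
    rw [← pow_succ']; congr 1; omega
  rw [Finset.mem_Icc] at hi
  apply Real.sq_sqrt
  apply mul_nonneg
  · exact auxY_nonneg m l hl k (by omega) _ (by rw [Finset.mem_Icc, e]; omega)
  · exact auxY_nonneg m l hl k (by omega) _ (by rw [Finset.mem_Icc, e]; omega)

lemma aux_tree_eq (m : ℕ) (y : ℕ → ℕ → ℝ)
    (h1 : ∀ k, 1 ≤ k → k ≤ m → ∀ i ∈ Finset.Icc 1 (2 ^ (m - k)),
          (y k i) ^ 2 = y (k - 1) (2 * i - 1) * y (k - 1) (2 * i)) :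
    y m 1 ^ (2 ^ m) = ∏ j ∈ Finset.Icc 1 (2 ^ m), y 0 j := by
  have key : ∀ k, k ≤ m → (∏ i ∈ Finset.Icc 1 (2 ^ (m - k)), y k i) ^ (2 ^ k) =
      ∏ j ∈ Finset.Icc 1 (2 ^ m), y 0 j := by
    intro k
    induction k with
    | zero => intro _; simp
    | succ k ih =>
      intro hk
      rw [← ih (by omega), pow_succ' 2 k, pow_mul]
      congr 1
      rw [show m - k = (m - (k + 1)) + 1 by omega, pow_succ' 2 (m - (k+1)), aux_pair,
        ← Finset.prod_pow]
      exact Finset.prod_congr rfl fun i hi => h1 (k + 1) (by omega) hk i hi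
  simpa using key m le_rfl

lemma aux_mono {n : ℕ} (A : Finset (Fin n → ℝ)) (lam : (Fin n → ℝ) → ℝ) (b : Fin n → ℝ)
    (hb : ∑ α ∈ A, lam α • α = b) (a : Fin n → ℝ) (ha : ∀ i, 0 < a i) :
    ∏ α ∈ A, (∏ i, a i ^ (α i)) ^ (lam α) = ∏ i, a i ^ (b i) := by
  have : ∀ α ∈ A, (∏ i, a i ^ (α i)) ^ (lam α) = ∏ i, a i ^ (lam α * α i) := by
    intro α _
    rw [← Real.finset_prod_rpow _ _ (fun i _ => (Real.rpow_pos_of_pos (ha i) _).le)]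
    refine Finset.prod_congr rfl fun i _ => ?_
    rw [← Real.rpow_mul (ha i).le, mul_comm]
  rw [Finset.prod_congr rfl this, Finset.prod_comm]
  refine Finset.prod_congr rfl fun i _ => ?_
  rw [← Real.rpow_sum_of_pos (ha i), ← hb]
  simp [Finset.sum_apply]

lemma aux_interp {n : ℕ} (A : Finset (Fin n → ℝ)) (hA : A.Nonempty)
    (hind : AffineIndependent ℝ (fun x : A => (x : Fin n → ℝ))) (g : (Fin n → ℝ) → ℝ) :
    ∃ (w : Fin n → ℝ) (t : ℝ), ∀ α ∈ A, ∑ i, w i * α i = g α + t := by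
  obtain ⟨a0, h0⟩ := hA
  rw [affineIndependent_iff_linearIndependent_vsub ℝ _ (⟨a0, h0⟩ : A)] at hind
  obtain ⟨f, hf⟩ := LinearMap.exists_extend
    ((Module.Basis.span hind).constr ℝ (fun x => g x.1.1 - g a0))
  have hf1 : ∀ α ∈ A, f (α - a0) = g α - g a0 := by
    intro α hα
    by_cases h : α = a0
    · simp [h]
    · have h1 := (Module.Basis.span hind).constr_basis ℝ (fun x => g x.1.1 - g a0)
        ⟨⟨α, hα⟩, fun h' => h (congrArg Subtype.val h')⟩
      rw [← hf, LinearMap.comp_apply, Submodule.subtype_apply, Module.Basis.span_apply] at h1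
      exact h1
  refine ⟨fun i => f (Pi.single i 1), f a0 - g a0, fun α hα => ?_⟩
  have h2 : f α = ∑ i, f (Pi.single i 1) * α i := by
    rw [LinearMap.pi_apply_eq_sum_univ f α]
    refine Finset.sum_congr rfl fun i _ => ?_
    rw [smul_eq_mul, mul_comm]
    congr 2
    funext j
    simp [Pi.single_apply, eq_comm]
  have h3 := hf1 α hα
  rw [map_sub] at h3
  rw [← h2]
  linarith

lemma aux_inPo {n : ℕ} (A : Finset (Fin n → ℝ)) (β : Fin n → ℕ)
    (hβA : (fun i => (β i : ℝ)) ∉ A) (lam : (Fin n → ℝ) → ℝ)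
    (hl : ∀ α ∈ A, 0 ≤ lam α) (hs : ∑ α ∈ A, lam α = 1)
    (hb : ∑ α ∈ A, lam α • α = fun i => (β i : ℝ))
    (s : (Fin n → ℝ) → ℝ) (hspos : ∀ α ∈ A, 0 ≤ s α) (e : ℝ) (he : |e| ≤ 1) :
    InPo n A β (fun γ => if γ ∈ A then lam γ * s γ else e * ∏ α ∈ A, s α ^ lam α) := by
  refine ⟨fun α hα => by simpa [hα] using mul_nonneg (hl α hα) (hspos α hα), fun x hx => ?_⟩
  have hx' : ∀ i, 0 < |x i| := fun i => abs_pos.2 (hx i)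
  have hM : ∀ α : Fin n → ℝ, 0 ≤ ∏ i, |x i| ^ (α i) := fun α =>
    Finset.prod_nonneg fun i _ => (Real.rpow_pos_of_pos (hx' i) _).le
  have hS : 0 ≤ ∏ α ∈ A, s α ^ lam α :=
    Finset.prod_nonneg fun α hα => Real.rpow_nonneg (hspos α hα) _
  have h1 := Real.geom_mean_le_arith_mean_weighted A lam (fun α => s α * ∏ i, |x i| ^ (α i))
    hl hs (fun α hα => mul_nonneg (hspos α hα) (hM α))
  have h2 : ∏ α ∈ A, (s α * ∏ i, |x i| ^ (α i)) ^ lam α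
      = (∏ α ∈ A, s α ^ lam α) * |∏ i, x i ^ (β i)| := by
    rw [Finset.prod_congr rfl (fun α hα => Real.mul_rpow (hspos α hα) (hM α)),
      Finset.prod_mul_distrib, aux_mono A lam _ hb _ hx', Finset.abs_prod]
    simp [abs_pow]
  rw [h2] at h1
  have h3 : ∑ α ∈ A, (if α ∈ A then lam α * s α else e * ∏ α ∈ A, s α ^ lam α) *
      ∏ i, |x i| ^ (α i) = ∑ α ∈ A, lam α * (s α * ∏ i, |x i| ^ (α i)) :=
    Finset.sum_congr rfl fun α hα => by rw [if_pos hα]; ring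
  simp only [hβA, if_false]
  rw [h3]
  have h4 : |e * (∏ α ∈ A, s α ^ lam α) * ∏ i, x i ^ (β i)| ≤
      (∏ α ∈ A, s α ^ lam α) * |∏ i, x i ^ (β i)| := by
    rw [abs_mul, abs_mul, abs_of_nonneg hS]
    apply mul_le_mul_of_nonneg_right _ (abs_nonneg _)
    exact mul_le_of_le_one_left hS he
  have := neg_abs_le (e * (∏ α ∈ A, s α ^ lam α) * ∏ i, x i ^ (β i))
  linarith

lemma aux_dual {n : ℕ} (A : Finset (Fin n → ℝ)) (β : Fin n → ℕ) (hodd : ∃ i, Odd (β i))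
    (hβA : (fun i => (β i : ℝ)) ∉ A) (hA : A.Nonempty)
    (hind : AffineIndependent ℝ (fun x : A => (x : Fin n → ℝ)))
    (lam : (Fin n → ℝ) → ℝ)
    (hl : ∀ α ∈ A, 0 < lam α) (hs : ∑ α ∈ A, lam α = 1)
    (hb : ∑ α ∈ A, lam α • α = fun i => (β i : ℝ)) (v : (Fin n → ℝ) → ℝ) :
    (∀ c : (Fin n → ℝ) → ℝ, InPo n A β c →
        0 ≤ ∑ α ∈ A, v α * c α + v (fun i => (β i : ℝ)) * c (fun i => (β i : ℝ))) ↔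
      (∀ α ∈ A, 0 ≤ v α) ∧ |v (fun i => (β i : ℝ))| ≤ ∏ α ∈ A, v α ^ lam α := by
  set b : Fin n → ℝ := fun i => (β i : ℝ) with hbdef
  constructor
  · intro H
    have hv : ∀ α ∈ A, 0 ≤ v α := by
      intro α hα
      have := H (fun γ => if γ = α then 1 else 0) ⟨fun γ _ => by dsimp only; split_ifs <;> norm_num, ?_⟩
      · have hne : b ≠ α := fun h => hβA (h ▸ hα)
        simpa [hne, hα] using this
      · intro x hx
        have hne : b ≠ α := fun h => hβA (h ▸ hα)
        simp only [← hbdef, hne, if_false, zero_mul, add_zero]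
        refine Finset.sum_nonneg fun γ _ => mul_nonneg (by split_ifs <;> norm_num) ?_
        exact Finset.prod_nonneg fun i _ => Real.rpow_nonneg (abs_nonneg _) _
    refine ⟨hv, ?_⟩
    have key : ∀ ε : ℝ, 0 < ε → |v b| ≤ ∏ α ∈ A, (v α + ε) ^ lam α := by
      intro ε hε
      have hpos : ∀ α ∈ A, 0 < v α + ε := fun α hα => by linarith [hv α hα]
      obtain ⟨e, he, hev⟩ : ∃ e : ℝ, |e| ≤ 1 ∧ v b * e = -|v b| := by
        rcases le_total 0 (v b) with h | h
        · exact ⟨-1, by simp, by rw [abs_of_nonneg h]; ring⟩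
        · exact ⟨1, by simp, by rw [abs_of_nonpos h]; ring⟩
      have := H _ (aux_inPo A β hβA lam (fun α hα => (hl α hα).le) hs hb (fun α => (v α + ε)⁻¹)
        (fun α hα => (inv_pos.2 (hpos α hα)).le) e he)
      simp only [← hbdef, hβA, if_false] at this
      have h2 : ∑ α ∈ A, v α * (if α ∈ A then lam α * (v α + ε)⁻¹
          else e * ∏ α ∈ A, (v α + ε)⁻¹ ^ lam α) ≤ 1 := by
        rw [← hs]
        refine Finset.sum_le_sum fun α hα => ?_
        rw [if_pos hα]
        have h3 : v α * (v α + ε)⁻¹ ≤ 1 := by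
          rw [← div_eq_mul_inv, div_le_one (hpos α hα)]; linarith
        have := mul_le_mul_of_nonneg_left h3 (hl α hα).le
        linarith
      have h4 : ∏ α ∈ A, (v α + ε)⁻¹ ^ lam α = (∏ α ∈ A, (v α + ε) ^ lam α)⁻¹ := by
        rw [← Finset.prod_inv_distrib]
        exact Finset.prod_congr rfl fun α hα => Real.inv_rpow (hpos α hα).le _
      rw [h4] at this h2
      have hP : 0 < ∏ α ∈ A, (v α + ε) ^ lam α :=
        Finset.prod_pos fun α hα => Real.rpow_pos_of_pos (hpos α hα) _
      rw [← mul_assoc, hev] at this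
      have h5 : |v b| * (∏ α ∈ A, (v α + ε) ^ lam α)⁻¹ ≤ 1 := by linarith
      rwa [← div_eq_mul_inv, div_le_one hP] at h5
    have hc : Continuous (fun ε : ℝ => ∏ α ∈ A, (v α + ε) ^ lam α) := by
      refine continuous_finset_prod _ fun α hα => ?_
      exact (continuous_const.add continuous_id).rpow_const (fun _ => Or.inr (hl α hα).le)
    have ht : Filter.Tendsto (fun ε : ℝ => ∏ α ∈ A, (v α + ε) ^ lam α) (nhdsWithin 0 (Set.Ioi 0))
        (nhds (∏ α ∈ A, (v α + 0) ^ lam α)) := hc.continuousAt.tendsto.mono_left nhdsWithin_le_nhds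
    simp only [add_zero] at ht
    exact ge_of_tendsto ht (Filter.eventually_of_mem self_mem_nhdsWithin key)
  · rintro ⟨hv, hD⟩ c ⟨hc0, hc⟩
    by_cases hz : ∀ α ∈ A, v α ≠ 0
    · have hvpos : ∀ α ∈ A, 0 < v α := fun α hα => lt_of_le_of_ne (hv α hα) (hz α hα).symm
      obtain ⟨w, t, hw⟩ := aux_interp A hA hind (fun α => Real.log (v α))
      have hmon : ∀ α ∈ A, ∏ i, Real.exp (w i) ^ (α i) = v α * Real.exp t := by
        intro α hα
        simp_rw [← Real.exp_mul]
        rw [← Real.exp_sum, hw α hα, Real.exp_add, Real.exp_log (hvpos α hα)]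
      have hB := aux_mono A lam b hb (fun i => Real.exp (w i)) (fun i => Real.exp_pos _)
      rw [Finset.prod_congr rfl (fun α hα => by
        rw [hmon α hα, Real.mul_rpow (hv α hα) (Real.exp_pos t).le]),
        Finset.prod_mul_distrib, ← Real.rpow_sum_of_pos (Real.exp_pos t), hs, Real.rpow_one] at hB
      obtain ⟨i0, hi0⟩ := hodd
      have hB' : ∏ i, Real.exp (w i) ^ (β i) = (∏ α ∈ A, v α ^ lam α) * Real.exp t := by
        rw [hB]; exact Finset.prod_congr rfl fun i _ => by simp [hbdef]
      have p1 := hc (fun i => Real.exp (w i)) (fun i => (Real.exp_pos _).ne')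
      have p2 := hc (fun i => (if i = i0 then -1 else 1) * Real.exp (w i))
        (fun i => mul_ne_zero (by split_ifs <;> norm_num) (Real.exp_pos _).ne')
      have habs : ∀ i, |(if i = i0 then (-1:ℝ) else 1) * Real.exp (w i)| = Real.exp (w i) := by
        intro i; split_ifs <;> simp
      have hsgn : ∏ i, ((if i = i0 then (-1:ℝ) else 1) * Real.exp (w i)) ^ (β i)
          = - ∏ i, Real.exp (w i) ^ (β i) := by
        simp_rw [mul_pow]
        rw [Finset.prod_mul_distrib]
        have : ∏ i, (if i = i0 then (-1:ℝ) else 1) ^ (β i) = -1 := by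
          rw [Finset.prod_eq_single i0]
          · simp [hi0.neg_one_pow]
          · intro j _ hj; simp [hj]
          · simp
        rw [this]; ring
      simp only [habs, hsgn, Real.abs_exp, ← hbdef] at p1 p2
      have hsum : ∑ α ∈ A, c α * ∏ i, Real.exp (w i) ^ (α i)
          = (∑ α ∈ A, v α * c α) * Real.exp t := by
        rw [Finset.sum_mul]
        exact Finset.sum_congr rfl fun α hα => by rw [hmon α hα]; ring
      rw [hsum, hB'] at p1 p2
      have q1 : 0 ≤ ∑ α ∈ A, v α * c α + c b * ∏ α ∈ A, v α ^ lam α := by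
        refine nonneg_of_mul_nonneg_left (b := Real.exp t) ?_ (Real.exp_pos t)
        linarith
      have q2 : 0 ≤ ∑ α ∈ A, v α * c α - c b * ∏ α ∈ A, v α ^ lam α := by
        refine nonneg_of_mul_nonneg_left (b := Real.exp t) ?_ (Real.exp_pos t)
        linarith
      have h1 : |v b * c b| ≤ |c b| * ∏ α ∈ A, v α ^ lam α := by
        rw [abs_mul, mul_comm]
        exact mul_le_mul_of_nonneg_left hD (abs_nonneg _)
      have h2 := neg_abs_le (v b * c b)
      rcases abs_cases (c b) with ⟨h, _⟩ | ⟨h, _⟩ <;> rw [h] at h1 <;> linarith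
    · push Not at hz
      obtain ⟨α, hα, h0⟩ := hz
      have : ∏ α ∈ A, v α ^ lam α = 0 :=
        Finset.prod_eq_zero hα (by rw [h0, Real.zero_rpow (hl α hα).ne'])
      rw [this] at hD
      have hvb : v b = 0 := abs_nonpos_iff.1 hD
      rw [hvb, zero_mul, add_zero]
      exact Finset.sum_nonneg fun α hα => mul_nonneg (hv α hα) (hc0 α hα)

/-- Second-order (binary tree) characterization of the dual cone `(Pᵒ(A, β))*` for a
rational circuit `(A, β)` with `A ⊆ ℚⁿ`, `β ∈ ℕⁿ` having an odd coordinate, and leaf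
assignment `σ`. -/
theorem stmt17 (n : ℕ) (A : Finset (Fin n → ℝ))
    (hArat : ∀ α ∈ A, ∀ i, ∃ q : ℚ, α i = (q : ℝ))
    (β : Fin n → ℕ) (hodd : ∃ i, Odd (β i))
    (hβA : (fun i => (β i : ℝ)) ∉ A)
    (hind : AffineIndependent ℝ (fun x : A => (x : Fin n → ℝ)))
    (p : ℕ) (pA : (Fin n → ℝ) → ℕ) (hp : 0 < p) (hpA : ∀ α ∈ A, 0 < pA α)
    (hpsum : ∑ α ∈ A, pA α = p)
    (hbary : ∑ α ∈ A, ((pA α : ℝ) / p) • α = fun i => (β i : ℝ))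
    (m : ℕ) (hm : m = Nat.clog 2 p)
    (σ : ℕ → (Fin n → ℝ))
    (hσmem : ∀ j ∈ Finset.Icc 1 (2 ^ m), σ j ∈ A ∨ σ j = fun i => (β i : ℝ))
    (hσA : ∀ α ∈ A, ((Finset.Icc 1 (2 ^ m)).filter fun j => σ j = α).card = pA α)
    (hσβ : ((Finset.Icc 1 (2 ^ m)).filter
      fun j => σ j = fun i => (β i : ℝ)).card = 2 ^ m - p)
    (v : (Fin n → ℝ) → ℝ) :
    (∀ c : (Fin n → ℝ) → ℝ, InPo n A β c →
        0 ≤ ∑ α ∈ A, v α * c α + v (fun i => (β i : ℝ)) * c (fun i => (β i : ℝ))) ↔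
      ∃ (yβ : ℝ) (y : ℕ → ℕ → ℝ),
        |v (fun i => (β i : ℝ))| ≤ yβ ∧
        (∀ j ∈ Finset.Icc 1 (2 ^ m),
          y 0 j = if σ j ∈ A then v (σ j) else yβ) ∧
        y m 1 = yβ ∧
        (∀ k, k ≤ m → ∀ i ∈ Finset.Icc 1 (2 ^ (m - k)), 0 ≤ y k i) ∧
        (∀ k, 1 ≤ k → k ≤ m → ∀ i ∈ Finset.Icc 1 (2 ^ (m - k)),
          (y k i) ^ 2 ≤ y (k - 1) (2 * i - 1) * y (k - 1) (2 * i)) := by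
  set b : Fin n → ℝ := fun i => (β i : ℝ) with hbdef
  have hA : A.Nonempty := by
    rw [Finset.nonempty_iff_ne_empty]
    rintro rfl
    simp at hpsum; omega
  have hpR : (0 : ℝ) < p := by exact_mod_cast hp
  have hl : ∀ α ∈ A, 0 < (pA α : ℝ) / p := fun α hα => by
    have := hpA α hα
    positivity
  have hs : ∑ α ∈ A, (pA α : ℝ) / p = 1 := by
    rw [← Finset.sum_div, ← Nat.cast_sum, hpsum, div_self hpR.ne']
  have hp2 : p ≤ 2 ^ m := by
    rw [hm]; exact Nat.le_pow_clog (by norm_num) p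
  have hGp : (∀ α ∈ A, 0 ≤ v α) →
      (∏ α ∈ A, v α ^ ((pA α : ℝ) / p)) ^ p = ∏ α ∈ A, v α ^ pA α := by
    intro hv
    rw [← Finset.prod_pow]
    refine Finset.prod_congr rfl fun α hα => ?_
    rw [← Real.rpow_natCast, ← Real.rpow_mul (hv α hα), div_mul_cancel₀ _ hpR.ne',
      Real.rpow_natCast]
  have hleaf : ∀ yβ : ℝ, ∏ j ∈ Finset.Icc 1 (2 ^ m), (if σ j ∈ A then v (σ j) else yβ)
      = (∏ α ∈ A, v α ^ pA α) * yβ ^ (2 ^ m - p) := by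
    intro yβ
    rw [← Finset.prod_fiberwise_of_maps_to (s := Finset.Icc 1 (2 ^ m)) (t := insert b A) (g := σ)
      (fun j hj => by
        rcases hσmem j hj with h | h
        · exact Finset.mem_insert_of_mem h
        · rw [h]; exact Finset.mem_insert_self _ _), Finset.prod_insert hβA, mul_comm]
    congr 1
    · refine Finset.prod_congr rfl fun α hα => ?_
      rw [← hσA α hα]
      apply Finset.prod_eq_pow_card
      intro j hj
      rw [(Finset.mem_filter.1 hj).2, if_pos hα]
    · rw [← hσβ]
      apply Finset.prod_eq_pow_card
      intro j hj
      rw [(Finset.mem_filter.1 hj).2, if_neg hβA]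
  rw [aux_dual A β hodd hβA hA hind (fun α => (pA α : ℝ) / p) hl hs hbary v]
  simp only [← hbdef]
  constructor
  · rintro ⟨hv, hD⟩
    set G := ∏ α ∈ A, v α ^ ((pA α : ℝ) / p) with hG
    have hG0 : 0 ≤ G := le_trans (abs_nonneg _) hD
    set l : ℕ → ℝ := fun j => if σ j ∈ A then v (σ j) else G with hldef
    have hl0 : ∀ j ∈ Finset.Icc 1 (2 ^ m), 0 ≤ l j := by
      intro j _
      simp only [hldef]
      split_ifs with h
      · exact hv _ h
      · exact hG0
    refine ⟨G, auxY l, hD, fun j _ => rfl, ?_, auxY_nonneg m l hl0,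
      fun k h1 h2 i hi => (auxY_sq m l hl0 k h1 h2 i hi).le⟩
    have h := aux_tree_eq m (auxY l) (auxY_sq m l hl0)
    have h' : ∏ j ∈ Finset.Icc 1 (2 ^ m), auxY l 0 j = G ^ (2 ^ m) := by
      have := hleaf G
      rw [← hGp hv, ← pow_add, Nat.add_sub_cancel' hp2] at this
      exact this
    rw [h'] at h
    exact (pow_left_inj₀ (auxY_nonneg m l hl0 m le_rfl 1 (by simp)) hG0 (by positivity)).1 h
  · rintro ⟨yβ, y, hy, hy0, hym, hnn, hsq⟩
    have hv : ∀ α ∈ A, 0 ≤ v α := by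
      intro α hα
      have : 0 < ((Finset.Icc 1 (2 ^ m)).filter fun j => σ j = α).card := by
        rw [hσA α hα]; exact hpA α hα
      obtain ⟨j, hj⟩ := Finset.card_pos.1 this
      obtain ⟨hj1, hj2⟩ := Finset.mem_filter.1 hj
      have h := hnn 0 (Nat.zero_le _) j (by simpa using hj1)
      rwa [hy0 j hj1, hj2, if_pos hα] at h
    refine ⟨hv, le_trans hy ?_⟩
    have hyβ : 0 ≤ yβ := le_trans (abs_nonneg _) hy
    have hG0 : 0 ≤ ∏ α ∈ A, v α ^ ((pA α : ℝ) / p) :=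
      Finset.prod_nonneg fun α hα => Real.rpow_nonneg (hv α hα) _
    rcases hyβ.eq_or_lt with h0 | hpos
    · rw [← h0]; exact hG0
    have h := aux_tree_le m y hnn hsq
    rw [Finset.prod_congr rfl hy0, hleaf, hym, ← hGp hv] at h
    have e : yβ ^ 2 ^ m = yβ ^ p * yβ ^ (2 ^ m - p) := by
      rw [← pow_add, Nat.add_sub_cancel' hp2]
    rw [e] at h
    have h2 := le_of_mul_le_mul_right h (by positivity)
    exact (pow_le_pow_iff_left₀ hyβ hG0 hp.ne').1 h2
end
end

section
/- Let ∅ ≠ A ⊆ ℝⁿ be a finite set, β ∈ ℕⁿ \ A with at least one odd coordinate, and c ∈ ℝ^{A∪{β}} with c_α ≥ 0 for all α ∈ A. Then the odd AG function Σ_{α∈A} c_α·∏_j |x_j|^{α_j} + c_β·∏_j x_j^{β_j} is nonnegative for all x ∈ ℝⁿ with all coordinates nonzero if and only if the even AG function Σ_{α∈A} c_α·∏_j |x_j|^{α_j} − |c_β|·∏_j |x_j|^{β_j} is nonnegative for all x ∈ ℝⁿ with all coordinates nonzero. -/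
/-- An odd AG function (with `c_α ≥ 0` on `A` and inner exponent `β ∈ ℕⁿ \ A` having an
odd coordinate) is nonnegative on points with nonzero coordinates iff the associated even
AG function, obtained by replacing `c_β·x^β` with `−|c_β|·|x|^β`, is nonnegative there. -/
theorem stmt19 (n : ℕ) (A : Finset (Fin n → ℝ)) (hA : A.Nonempty)
    (β : Fin n → ℕ) (hβ : (fun i => (β i : ℝ)) ∉ A) (hodd : ∃ i, Odd (β i))
    (c : (Fin n → ℝ) → ℝ) (hc : ∀ α ∈ A, 0 ≤ c α) :
    (∀ x : Fin n → ℝ, (∀ i, x i ≠ 0) →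
        0 ≤ ∑ α ∈ A, c α * ∏ i, |x i| ^ (α i)
              + c (fun i => (β i : ℝ)) * ∏ i, x i ^ (β i)) ↔
      (∀ x : Fin n → ℝ, (∀ i, x i ≠ 0) →
        0 ≤ ∑ α ∈ A, c α * ∏ i, |x i| ^ (α i)
              - |c (fun i => (β i : ℝ))| * ∏ i, |x i| ^ (β i)) := by
  obtain ⟨k, hk⟩ := hodd
  constructor
  · intro h x hx
    rcases le_total 0 (c (fun i => (β i : ℝ))) with h0 | h0
    · have hy := h (fun i => if i = k then -|x i| else |x i|) (by
        intro i
        by_cases hi : i = k <;> simp [hi, hx])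
      have h1 : ∀ i, |(if i = k then -|x i| else |x i|)| = |x i| := by
        intro i
        by_cases hi : i = k <;> simp [hi]
      have h2 : ∏ i, (if i = k then -|x i| else |x i|) ^ (β i) = - ∏ i, |x i| ^ (β i) := by
        have h3 : ∀ i, (if i = k then -|x i| else |x i|) ^ (β i)
            = (if i = k then (-1 : ℝ) else 1) * |x i| ^ (β i) := by
          intro i
          by_cases hi : i = k
          · subst hi
            simp only [if_true]
            rw [hk.neg_pow]
            ring
          · simp [hi]
        rw [Finset.prod_congr rfl (fun i _ => h3 i), Finset.prod_mul_distrib]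
        simp
      simp only [h1] at hy
      rw [h2] at hy
      rw [abs_of_nonneg h0]
      linarith
    · have hy := h (fun i => |x i|) (by
        intro i
        simp [hx])
      simp only [abs_abs] at hy
      rw [abs_of_nonpos h0]
      linarith
  · intro h x hx
    have hy := h x hx
    have h1 := neg_abs_le (c (fun i => (β i : ℝ)) * ∏ i, x i ^ (β i))
    rw [abs_mul, Finset.abs_prod] at h1
    simp only [abs_pow] at h1
    linarith
end
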